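/- arXiv:1609.06683 — 6 statements merged into one kernel-verified Lean document; each statement's English description precedes it below -/
import Mathlib

section
/- Let q ∈ (2,3), M > 0, K_∞ > 0 and ε > 0. Then there exist real numbers 0 < t₀ < t₁ and a constant C > 0 such that for all t ≥ 0 and all real numbers v > 0 and k > 0 with k ≤ M·v and k ≤ K_∞, one has k·t^q ≤ ε·(v·t² + t³) + C·k·t³·𝟙_{[t₀,t₁]}(t), where 𝟙_{[t₀,t₁]}(t) equals 1 if t₀ ≤ t ≤ t₁ and 0 otherwise. -/
/-- Let `q ∈ (2,3)`, `M > 0`, `K_∞ > 0` and `ε > 0`.  Then there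
exist `0 < t₀ < t₁` and `C > 0` such that for all `t ≥ 0` and all `v > 0`,
`k > 0` with `k ≤ M·v` and `k ≤ K_∞`:
`k·t^q ≤ ε·(v·t² + t³) + C·k·t³·𝟙_{[t₀,t₁]}(t)`. -/
theorem stmt_10 (q : ℝ) (hq : 2 < q) (hq' : q < 3)
    (M Kinf ε : ℝ) (hM : 0 < M) (hKinf : 0 < Kinf) (hε : 0 < ε) :
    ∃ t₀ t₁ C : ℝ, 0 < t₀ ∧ t₀ < t₁ ∧ 0 < C ∧
      ∀ t : ℝ, 0 ≤ t → ∀ v k : ℝ, 0 < v → 0 < k → k ≤ M * v → k ≤ Kinf →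
        k * t ^ q ≤ ε * (v * t ^ 2 + t ^ 3)
          + C * k * t ^ 3 * (Set.Icc t₀ t₁).indicator (fun _ => (1 : ℝ)) t := by
  have hq2 : 0 < q - 2 := by linarith
  have hq3 : q - 3 < 0 := by linarith
  obtain ⟨t₀, ht₀, hsmall⟩ : ∃ t₀ : ℝ, 0 < t₀ ∧ t₀ ^ (q - 2) = ε / M :=
    ⟨(ε / M) ^ (q - 2)⁻¹, by positivity, Real.rpow_inv_rpow (by positivity) hq2.ne'⟩
  obtain ⟨s, hs, hlarge⟩ : ∃ s : ℝ, 0 < s ∧ s ^ (q - 3) = ε / Kinf :=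
    ⟨(ε / Kinf) ^ (q - 3)⁻¹, by positivity, Real.rpow_inv_rpow (by positivity) hq3.ne⟩
  refine ⟨t₀, max (t₀ + 1) s, t₀ ^ (q - 3), ht₀, lt_max_of_lt_left (lt_add_one t₀),
    by positivity, ?_⟩
  intro t ht v k hv hk hkv hkK
  have hnonneg : 0 ≤ ε * (v * t ^ 2 + t ^ 3) := by positivity
  rcases ht.eq_or_lt with rfl | htpos
  · simp [Real.zero_rpow (by linarith : q ≠ 0)]
  have htq2 : t ^ q = t ^ (q - 2) * t ^ 2 := by
    rw [← Real.rpow_natCast t 2, ← Real.rpow_add htpos]; norm_num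
  have htq3 : t ^ q = t ^ (q - 3) * t ^ 3 := by
    rw [← Real.rpow_natCast t 3, ← Real.rpow_add htpos]; norm_num
  by_cases hmem : t ∈ Set.Icc t₀ (max (t₀ + 1) s)
  · have hle : t ^ (q - 3) ≤ t₀ ^ (q - 3) :=
      Real.rpow_le_rpow_of_nonpos ht₀ hmem.1 hq3.le
    rw [Set.indicator_of_mem hmem, mul_one, htq3]
    calc k * (t ^ (q - 3) * t ^ 3) ≤ k * (t₀ ^ (q - 3) * t ^ 3) := by gcongr
      _ ≤ _ := by linarith
  rw [Set.indicator_of_notMem hmem, mul_zero, add_zero]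
  rcases lt_or_ge t t₀ with hlt | hge
  · have hle : t ^ (q - 2) ≤ ε / M :=
      hsmall ▸ Real.rpow_le_rpow ht hlt.le hq2.le
    calc k * t ^ q = k * t ^ (q - 2) * t ^ 2 := by rw [htq2, mul_assoc]
      _ ≤ M * v * (ε / M) * t ^ 2 := by gcongr
      _ = ε * (v * t ^ 2) := by field_simp
      _ ≤ ε * (v * t ^ 2 + t ^ 3) := by gcongr; exact le_add_of_nonneg_right (by positivity)
  · have hst : s ≤ t :=
      (le_max_right _ _).trans (not_le.mp fun h => hmem ⟨hge, h⟩).le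
    have hle : t ^ (q - 3) ≤ ε / Kinf :=
      hlarge ▸ Real.rpow_le_rpow_of_nonpos hs hst hq3.le
    calc k * t ^ q = k * t ^ (q - 3) * t ^ 3 := by rw [htq3, mul_assoc]
      _ ≤ Kinf * (ε / Kinf) * t ^ 3 := by gcongr
      _ = ε * t ^ 3 := by field_simp
      _ ≤ ε * (v * t ^ 2 + t ^ 3) := by gcongr; exact le_add_of_nonneg_left (by positivity)
end

section
/- Let q ∈ (2,3) and set C_q := (1/(3−q))·((q−2)/(3−q))^{2−q}. Let V, K : ℝ³ → ℝ with V(x) > 0 and K(x) > 0 for all x, and suppose K(x)/V(x)^{3−q} → 0 as |x| → +∞. Then for every ε > 0 there exists r > 0 such that for every x ∈ ℝ³ with |x| > r and every t > 0, one has K(x)·t^q ≤ ε·C_q⁻¹·(V(x)·t² + t³). -/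
/-- Interpolation between `t ^ 2` and `t ^ 3` by the weighted AM-GM inequality. -/
lemma rpow_mul_rpow_le_mul_sq_add_cube {q v t : ℝ} (hq : 2 ≤ q) (hq' : q ≤ 3)
    (hv : 0 ≤ v) (ht : 0 < t) : v ^ (3 - q) * t ^ q ≤ v * t ^ 2 + t ^ 3 := by
  have hvt : 0 ≤ v * t ^ 2 := by positivity
  have ht3 : 0 ≤ t ^ 3 := by positivity
  have amgm := Real.geom_mean_le_arith_mean2_weighted (sub_nonneg.2 hq') (sub_nonneg.2 hq)
    hvt ht3 (by ring)
  have factor : (v * t ^ 2) ^ (3 - q) * (t ^ 3) ^ (q - 2) = v ^ (3 - q) * t ^ q := by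
    rw [Real.mul_rpow hv (by positivity), ← Real.rpow_natCast t 2, ← Real.rpow_natCast t 3,
      ← Real.rpow_mul ht.le, ← Real.rpow_mul ht.le, mul_assoc, ← Real.rpow_add ht]
    congr 2
    push_cast
    ring
  rw [factor] at amgm
  nlinarith

/-- Let `q ∈ (2,3)` and `C_q := (1/(3−q))·((q−2)/(3−q))^(2−q)`.
Let `V, K : ℝ³ → ℝ` with `V(x) > 0`, `K(x) > 0` for all `x` and
`K(x)/V(x)^(3−q) → 0` as `|x| → +∞`.  Then for every `ε > 0` there is `r > 0`
such that for every `x` with `|x| > r` and every `t > 0`: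
`K(x)·t^q ≤ ε·C_q⁻¹·(V(x)·t² + t³)`. -/
theorem stmt_11 (q : ℝ) (hq : 2 < q) (hq' : q < 3)
    (V K : EuclideanSpace ℝ (Fin 3) → ℝ)
    (hV : ∀ x, 0 < V x) (hK : ∀ x, 0 < K x)
    (hVK : Filter.Tendsto (fun x => K x / V x ^ (3 - q))
      (Filter.comap (fun x : EuclideanSpace ℝ (Fin 3) => ‖x‖) Filter.atTop) (nhds 0)) :
    ∀ ε : ℝ, 0 < ε → ∃ r : ℝ, 0 < r ∧ ∀ x : EuclideanSpace ℝ (Fin 3), r < ‖x‖ →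
      ∀ t : ℝ, 0 < t →
        K x * t ^ q ≤ ε * ((1 / (3 - q)) * ((q - 2) / (3 - q)) ^ (2 - q))⁻¹
          * (V x * t ^ 2 + t ^ 3) := by
  intro ε hε
  set δ := ε * ((1 / (3 - q)) * ((q - 2) / (3 - q)) ^ (2 - q))⁻¹
  have h3 : 0 < 3 - q := by linarith
  have h2 : 0 < q - 2 := by linarith
  have hδ : 0 < δ := by positivity
  obtain ⟨a, ha⟩ := Filter.eventually_atTop.1
    (Filter.eventually_comap.1 (hVK.eventually_lt_const hδ))
  refine ⟨max a 1, by positivity, fun x hx t ht => ?_⟩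
  have hratio : K x / V x ^ (3 - q) < δ := ha ‖x‖ ((le_max_left a 1).trans hx.le) x rfl
  have hKx : K x ≤ δ * V x ^ (3 - q) :=
    ((div_lt_iff₀ (Real.rpow_pos_of_pos (hV x) _)).1 hratio).le
  calc K x * t ^ q ≤ δ * V x ^ (3 - q) * t ^ q := by gcongr
    _ = δ * (V x ^ (3 - q) * t ^ q) := mul_assoc _ _ _
    _ ≤ δ * (V x * t ^ 2 + t ^ 3) := by
      gcongr
      exact rpow_mul_rpow_le_mul_sq_add_cube hq.le hq'.le (hV x).le ht
end

section
/- Let q ∈ (2,3). Let V, K : ℝ³ → ℝ be continuous with V(x) > 0 and K(x) > 0 for all x, K bounded, K ≤ M·V pointwise for some M > 0, and suppose K satisfies: for every R > 0 and every sequence (A_n) of Borel subsets of ℝ³ with Lebesgue measure |A_n| ≤ R for all n, one has ∫_{A_n ∩ {|x| > r}} K(x) dx → 0 as r → +∞, uniformly in n. Let (u_n) be a sequence of measurable functions ℝ³ → ℂ⁴ and C' > 0 such that ∫_{ℝ³} V(x)·|u_n(x)|² dx ≤ C' and ∫_{ℝ³} |u_n(x)|³ dx ≤ C' for all n. Then for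 every ε > 0 there exists r > 0 such that ∫_{{|x| > r}} K(x)·|u_n(x)|^q dx ≤ ε for all n. -/
open MeasureTheory

/-- Interpolation of `t ^ q` between the powers `2` and `3`, with thresholds `a` and `b`. -/
lemma mul_rpow_le_interpolation {q a b k v c M t : ℝ} (hq : 2 < q) (hq' : q < 3) (ha : 0 < a)
    (hb : 0 < b) (hk : 0 < k) (hkc : k ≤ c) (hkv : k ≤ M * v) (ht : 0 ≤ t) :
    k * t ^ q ≤ M * a ^ (q - 2) * (v * t ^ 2) + c * b ^ (q - 3) * t ^ 3
      + (if a ≤ t then b ^ q * k else 0) := by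
  have hc : 0 < c := hk.trans_le hkc
  have h₁ : 0 ≤ M * a ^ (q - 2) * (v * t ^ 2) := by
    have : 0 ≤ (M * v) * (a ^ (q - 2) * t ^ 2) :=
      mul_nonneg (hk.le.trans hkv) (by positivity)
    linarith
  have h₂ : 0 ≤ c * b ^ (q - 3) * t ^ 3 := by positivity
  rcases ht.eq_or_lt with rfl | htpos
  · rw [Real.zero_rpow (by linarith), mul_zero]
    split_ifs <;> positivity
  by_cases hat : a ≤ t
  · rw [if_pos hat]
    rcases le_total t b with htb | hbt
    · have : t ^ q ≤ b ^ q := Real.rpow_le_rpow ht htb (by linarith)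
      nlinarith
    · have h : t ^ q ≤ b ^ (q - 3) * t ^ 3 := by
        have : t ^ q = t ^ (q - 3) * t ^ 3 := by
          rw [← Real.rpow_add_natCast htpos.ne']
          norm_num
        rw [this]
        gcongr ?_ * _
        exact Real.rpow_le_rpow_of_nonpos hb hbt (by linarith)
      have : k * t ^ q ≤ c * (b ^ (q - 3) * t ^ 3) := by gcongr
      have : 0 < b ^ q * k := by positivity
      linarith
  · rw [if_neg hat]
    have h : t ^ q ≤ a ^ (q - 2) * t ^ 2 := by
      have : t ^ q = t ^ (q - 2) * t ^ 2 := by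
        rw [← Real.rpow_add_natCast htpos.ne']
        norm_num
      rw [this]
      gcongr ?_ * _
      exact Real.rpow_le_rpow ht (not_le.mp hat).le (by linarith)
    have : k * t ^ q ≤ (M * v) * (a ^ (q - 2) * t ^ 2) :=
      mul_le_mul hkv h (by positivity) (hk.le.trans hkv)
    linarith

/-- The cube version of Markov's inequality, for the superlevel sets of a norm. -/
lemma measure_le_norm_le_of_lintegral_cube_le {α E : Type*} [MeasurableSpace α]
    {μ : Measure α} [NormedAddCommGroup E] {f : α → E} (hf : StronglyMeasurable f) {a C : ℝ}
    (ha : 0 < a) (h : ∫⁻ x, ENNReal.ofReal (‖f x‖ ^ 3) ∂μ ≤ ENNReal.ofReal C) :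
    μ {x | a ≤ ‖f x‖} ≤ ENNReal.ofReal (C / a ^ 3) := by
  have hmeas : Measurable fun x => ENNReal.ofReal (‖f x‖ ^ 3) :=
    (hf.norm.measurable.pow_const 3).ennreal_ofReal
  have hsub : {x | a ≤ ‖f x‖} ⊆
      {x | ENNReal.ofReal (a ^ 3) ≤ ENNReal.ofReal (‖f x‖ ^ 3)} := fun x hx =>
    ENNReal.ofReal_le_ofReal (pow_le_pow_left₀ ha.le hx 3)
  have ha3 : 0 < a ^ 3 := by positivity
  calc μ {x | a ≤ ‖f x‖} ≤ _ := measure_mono hsub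
    _ ≤ (∫⁻ x, ENNReal.ofReal (‖f x‖ ^ 3) ∂μ) / ENNReal.ofReal (a ^ 3) :=
      meas_ge_le_lintegral_div hmeas.aemeasurable (ENNReal.ofReal_pos.2 ha3).ne'
        ENNReal.ofReal_ne_top
    _ ≤ ENNReal.ofReal C / ENNReal.ofReal (a ^ 3) := by gcongr
    _ = ENNReal.ofReal (C / a ^ 3) := (ENNReal.ofReal_div_of_pos ha3).symm

/-- Let `q ∈ (2,3)`, `V, K : ℝ³ → ℝ` continuous and positive, `K`
bounded, `K ≤ M·V` pointwise for some `M > 0`, and suppose that for every `R > 0`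
and every sequence `(Aₙ)` of Borel sets of measure `≤ R`,
`∫_{Aₙ ∩ {|x|>r}} K dx → 0` as `r → ∞` uniformly in `n`.  Let `(uₙ)` be
measurable `ℝ³ → ℂ⁴` with `∫ V·|uₙ|² ≤ C'` and `∫ |uₙ|³ ≤ C'`.  Then for every
`ε > 0` there is `r > 0` with `∫_{|x|>r} K·|uₙ|^q dx ≤ ε` for all `n`. -/
theorem stmt_12 (q : ℝ) (hq : 2 < q) (hq' : q < 3)
    (V K : EuclideanSpace ℝ (Fin 3) → ℝ)
    (hVc : Continuous V) (hKc : Continuous K)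
    (hVpos : ∀ x, 0 < V x) (hKpos : ∀ x, 0 < K x)
    (Kbd : ℝ) (hKbd : ∀ x, K x ≤ Kbd)
    (M : ℝ) (hM : 0 < M) (hKV : ∀ x, K x ≤ M * V x)
    (hK1 : ∀ R : ℝ, 0 < R → ∀ A : ℕ → Set (EuclideanSpace ℝ (Fin 3)),
      (∀ n, MeasurableSet (A n)) → (∀ n, volume (A n) ≤ ENNReal.ofReal R) →
      ∀ ε : ℝ, 0 < ε → ∃ r₀ : ℝ, ∀ r : ℝ, r₀ ≤ r → ∀ n : ℕ,
        (∫ x in A n ∩ {x | r < ‖x‖}, K x) ≤ ε)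
    (u : ℕ → EuclideanSpace ℝ (Fin 3) → EuclideanSpace ℂ (Fin 4))
    (hu : ∀ n, MeasureTheory.StronglyMeasurable (u n))
    (C' : ℝ) (hC' : 0 < C')
    (hbound2 : ∀ n, (∫⁻ x, ENNReal.ofReal (V x * ‖u n x‖ ^ 2)) ≤ ENNReal.ofReal C')
    (hbound3 : ∀ n, (∫⁻ x, ENNReal.ofReal (‖u n x‖ ^ 3)) ≤ ENNReal.ofReal C') :
    ∀ ε : ℝ, 0 < ε → ∃ r : ℝ, 0 < r ∧ ∀ n : ℕ,
      (∫⁻ x in {x | r < ‖x‖}, ENNReal.ofReal (K x * ‖u n x‖ ^ q))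
        ≤ ENNReal.ofReal ε := by
  intro ε hε
  have hKbd0 : 0 < Kbd := (hKpos 0).trans_le (hKbd 0)
  obtain ⟨a, ha, haε⟩ : ∃ a : ℝ, 0 < a ∧ M * a ^ (q - 2) * C' = ε / 3 := by
    refine ⟨(ε / (3 * M * C')) ^ (q - 2)⁻¹, by positivity, ?_⟩
    rw [Real.rpow_inv_rpow (by positivity) (by linarith)]
    field_simp
  obtain ⟨b, hb, hbε⟩ : ∃ b : ℝ, 0 < b ∧ Kbd * b ^ (q - 3) * C' = ε / 3 := by
    refine ⟨(ε / (3 * Kbd * C')) ^ (q - 3)⁻¹, by positivity, ?_⟩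
    rw [Real.rpow_inv_rpow (by positivity) (by linarith)]
    field_simp
  set A : ℕ → Set (EuclideanSpace ℝ (Fin 3)) := fun n => {x | a ≤ ‖u n x‖}
  have hAm : ∀ n, MeasurableSet (A n) := fun n =>
    measurableSet_le measurable_const (hu n).norm.measurable
  have hAvol : ∀ n, volume (A n) ≤ ENNReal.ofReal (C' / a ^ 3) := fun n =>
    measure_le_norm_le_of_lintegral_cube_le (hu n) ha (hbound3 n)
  obtain ⟨r₀, hr₀⟩ := hK1 (C' / a ^ 3) (by positivity) A hAm hAvol (ε / (3 * b ^ q))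
    (by positivity)
  refine ⟨max r₀ 1, lt_max_of_lt_right one_pos, fun n => ?_⟩
  set r := max r₀ 1
  set S : Set (EuclideanSpace ℝ (Fin 3)) := {x | r < ‖x‖}
  have hKint : IntegrableOn K (A n ∩ S) := by
    refine Measure.integrableOn_of_bounded (M := Kbd) ?_ hKc.aestronglyMeasurable ?_
    · exact ((measure_mono Set.inter_subset_left).trans_lt
        ((hAvol n).trans_lt ENNReal.ofReal_lt_top)).ne
    · exact Filter.Eventually.of_forall fun x => by
        rw [Real.norm_of_nonneg (hKpos x).le]
        exact hKbd x
  have hthird : ∫⁻ x in A n ∩ S, ENNReal.ofReal (K x) ≤ ENNReal.ofReal (ε / (3 * b ^ q)) := by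
    rw [← ofReal_integral_eq_lintegral_ofReal hKint
      (Filter.Eventually.of_forall fun x => (hKpos x).le)]
    exact ENNReal.ofReal_le_ofReal (hr₀ r (le_max_left _ _) n)
  have hpt : ∀ x, ENNReal.ofReal (K x * ‖u n x‖ ^ q) ≤
      ENNReal.ofReal (M * a ^ (q - 2)) * ENNReal.ofReal (V x * ‖u n x‖ ^ 2)
      + ENNReal.ofReal (Kbd * b ^ (q - 3)) * ENNReal.ofReal (‖u n x‖ ^ 3)
      + (A n).indicator (fun x => ENNReal.ofReal (b ^ q) * ENNReal.ofReal (K x)) x := by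
    intro x
    refine (ENNReal.ofReal_le_ofReal (mul_rpow_le_interpolation hq hq' ha hb (hKpos x) (hKbd x)
      (hKV x) (norm_nonneg (u n x)))).trans ?_
    refine ENNReal.ofReal_add_le.trans (add_le_add (ENNReal.ofReal_add_le.trans ?_) ?_)
    · rw [ENNReal.ofReal_mul (by positivity), ENNReal.ofReal_mul (p := Kbd * _) (by positivity)]
    · rw [Set.indicator_apply]
      by_cases hx : a ≤ ‖u n x‖
      · rw [if_pos hx, if_pos (show x ∈ A n from hx), ENNReal.ofReal_mul (by positivity)]
      · rw [if_neg hx, ENNReal.ofReal_zero]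
        exact zero_le
  have hm2 : Measurable fun x => ENNReal.ofReal (V x * ‖u n x‖ ^ 2) :=
    (hVc.measurable.mul ((hu n).norm.measurable.pow_const 2)).ennreal_ofReal
  have hm3 : Measurable fun x => ENNReal.ofReal (‖u n x‖ ^ 3) :=
    ((hu n).norm.measurable.pow_const 3).ennreal_ofReal
  calc ∫⁻ x in S, ENNReal.ofReal (K x * ‖u n x‖ ^ q)
      ≤ ∫⁻ x in S, (ENNReal.ofReal (M * a ^ (q - 2)) * ENNReal.ofReal (V x * ‖u n x‖ ^ 2)
          + ENNReal.ofReal (Kbd * b ^ (q - 3)) * ENNReal.ofReal (‖u n x‖ ^ 3)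
          + (A n).indicator (fun x => ENNReal.ofReal (b ^ q) * ENNReal.ofReal (K x)) x) :=
        lintegral_mono hpt
    _ = ENNReal.ofReal (M * a ^ (q - 2)) * (∫⁻ x in S, ENNReal.ofReal (V x * ‖u n x‖ ^ 2))
        + ENNReal.ofReal (Kbd * b ^ (q - 3)) * (∫⁻ x in S, ENNReal.ofReal (‖u n x‖ ^ 3))
        + ENNReal.ofReal (b ^ q) * ∫⁻ x in A n ∩ S, ENNReal.ofReal (K x) := by
      rw [lintegral_add_right _
          ((hKc.measurable.ennreal_ofReal.const_mul _).indicator (hAm n)),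
        lintegral_add_left (hm2.const_mul _), lintegral_const_mul _ hm2,
        lintegral_const_mul _ hm3, lintegral_indicator (hAm n), Measure.restrict_restrict (hAm n),
        lintegral_const_mul _ hKc.measurable.ennreal_ofReal]
    _ ≤ ENNReal.ofReal (M * a ^ (q - 2)) * ENNReal.ofReal C'
        + ENNReal.ofReal (Kbd * b ^ (q - 3)) * ENNReal.ofReal C'
        + ENNReal.ofReal (b ^ q) * ENNReal.ofReal (ε / (3 * b ^ q)) := by
      gcongr
      · exact (setLIntegral_le_lintegral _ _).trans (hbound2 n)
      · exact (setLIntegral_le_lintegral _ _).trans (hbound3 n)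
    _ = ENNReal.ofReal ε := by
      have hbq : b ^ q * (ε / (3 * b ^ q)) = ε / 3 := by
        have : 0 < b ^ q := by positivity
        field_simp
      rw [← ENNReal.ofReal_mul (by positivity), ← ENNReal.ofReal_mul (by positivity),
        ← ENNReal.ofReal_mul (by positivity), haε, hbε, hbq,
        ← ENNReal.ofReal_add (by positivity) (by positivity),
        ← ENNReal.ofReal_add (by positivity) (by positivity)]
      congr 1
      ring
end

section
/- Let q ∈ (2,3). Let V, K : ℝ³ → ℝ be continuous with V(x) > 0 and K(x) > 0 for all x, K bounded, K ≤ M·V pointwise for some M > 0, and suppose K satisfies: for every R > 0 and every sequence (A_n) of Borel subsets of ℝ³ with Lebesgue measure |A_n| ≤ R for all n, one has ∫_{A_n ∩ {|x| > r}} K(x) dx → 0 as r → +∞, uniformly in n. Let (u_n) and u be measurable functions ℝ³ → ℂ⁴ such that ∫_{ℝ³} V·|u_n|² dx ≤ C' and ∫_{ℝ³} |u_n|³ dx ≤ C' for all n, ∫_{ℝ³} K·|u|^q dx < ∞, and for every r > 0 one has ∫_{B_r(0)} K·|u_n|^q dx → ∫_{B_r(0)} K·|u|^q dx as n → ∞.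 Then ∫_{ℝ³} K·|u_n|^q dx → ∫_{ℝ³} K·|u|^q dx as n → ∞. -/
open MeasureTheory

/-- Interpolation of `s ^ q`, `q ∈ [2, 3]`, between `s ^ 2` for small `s`, `s ^ 3` for large `s`,
and a constant for intermediate `s`. -/
theorem rpow_le_sq_add_cube_add_indicator {q a b s : ℝ} (hq : 2 ≤ q) (hq' : q ≤ 3)
    (ha : 0 < a) (hb : 0 < b) (hs : 0 ≤ s) :
    s ^ q ≤ a ^ (q - 2) * s ^ 2 + b ^ (q - 3) * s ^ 3
      + (Set.Ici a).indicator (fun _ => b ^ q) s := by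
  have h2 : 0 ≤ a ^ (q - 2) * s ^ 2 := by positivity
  have h3 : 0 ≤ b ^ (q - 3) * s ^ 3 := by positivity
  rcases hs.eq_or_lt with rfl | hs0
  · rw [Real.zero_rpow (by linarith), Set.indicator_of_notMem (by simpa using ha)]
    linarith
  have split (k : ℕ) : s ^ q = s ^ (q - k) * s ^ k := by
    rw [← Real.rpow_natCast, ← Real.rpow_add hs0]
    congr 1
    ring
  by_cases hsa : a ≤ s
  · rw [Set.indicator_of_mem (by simpa using hsa)]
    have hbq : 0 ≤ b ^ q := by positivity
    rcases le_total s b with hsb | hsb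
    · have := Real.rpow_le_rpow hs hsb (by linarith : 0 ≤ q)
      linarith
    · have : s ^ (q - 3) ≤ b ^ (q - 3) :=
        Real.rpow_le_rpow_of_nonpos hb hsb (by linarith)
      have h := mul_le_mul_of_nonneg_right this (by positivity : 0 ≤ s ^ 3)
      have e := split 3
      push_cast at e
      linarith
  · rw [Set.indicator_of_notMem (by simpa using hsa)]
    have : s ^ (q - 2) ≤ a ^ (q - 2) :=
      Real.rpow_le_rpow hs (not_le.mp hsa).le (by linarith)
    have h := mul_le_mul_of_nonneg_right this (by positivity : 0 ≤ s ^ 2)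
    have e := split 2
    push_cast at e
    linarith

theorem integrable_and_integral_le_of_lintegral_ofReal_le {α : Type*} [MeasurableSpace α]
    {μ : Measure α} {f : α → ℝ} {C : ℝ} (hf : AEStronglyMeasurable f μ) (hf0 : ∀ x, 0 ≤ f x)
    (hC : 0 ≤ C) (h : ∫⁻ x, ENNReal.ofReal (f x) ∂μ ≤ ENNReal.ofReal C) :
    Integrable f μ ∧ ∫ x, f x ∂μ ≤ C := by
  refine ⟨⟨hf, ?_⟩, ?_⟩
  · rw [hasFiniteIntegral_iff_ofReal (.of_forall hf0)]
    exact h.trans_lt ENNReal.ofReal_lt_top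
  · rw [integral_eq_lintegral_of_nonneg_ae (.of_forall hf0) hf]
    exact ENNReal.toReal_le_of_le_ofReal hC h

/-- Convergence on every ball, together with uniformly small tails, gives convergence of the
integrals over the whole space. -/
theorem tendsto_integral_of_tendsto_ball_of_tail {E : Type*} [NormedAddCommGroup E]
    [MeasurableSpace E] [OpensMeasurableSpace E] {μ : Measure E} {f : ℕ → E → ℝ} {g : E → ℝ}
    (hf : ∀ n, Integrable (f n) μ) (hf0 : ∀ n x, 0 ≤ f n x) (hg : Integrable g μ)
    (hball : ∀ r : ℝ, 0 < r → Filter.Tendsto (fun n => ∫ x in Metric.ball (0 : E) r, f n x ∂μ)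
      Filter.atTop (nhds (∫ x in Metric.ball (0 : E) r, g x ∂μ)))
    (htail : ∀ ε : ℝ, 0 < ε → ∃ r₀ : ℝ, ∀ r : ℝ, r₀ ≤ r → ∀ n : ℕ,
      ∫ x in (Metric.ball (0 : E) r)ᶜ, f n x ∂μ ≤ ε) :
    Filter.Tendsto (fun n => ∫ x, f n x ∂μ) Filter.atTop (nhds (∫ x, g x ∂μ)) := by
  rw [Metric.tendsto_atTop]
  intro ε hε
  obtain ⟨r₀, hr₀⟩ := htail (ε / 4) (by positivity)
  have hgball : Filter.Tendsto (fun r : ℝ => ∫ x in Metric.ball (0 : E) r, g x ∂μ) Filter.atTop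
      (nhds (∫ x, g x ∂μ)) :=
    (aecover_ball Filter.tendsto_id).integral_tendsto_of_countably_generated hg
  obtain ⟨r, hgr, hrr₀, hr⟩ := ((hgball.eventually (Metric.ball_mem_nhds _
    (by positivity : 0 < ε / 4))).and ((Filter.eventually_ge_atTop r₀).and
    (Filter.eventually_gt_atTop 0))).exists
  obtain ⟨N, hN⟩ := Metric.tendsto_atTop.mp (hball r hr) (ε / 4) (by positivity)
  refine ⟨N, fun n hn => ?_⟩
  have h1 := hN n hn
  have h2 := hr₀ r hrr₀ n
  have h3 : 0 ≤ ∫ x in (Metric.ball (0 : E) r)ᶜ, f n x ∂μ := integral_nonneg (hf0 n)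
  have h4 := integral_add_compl (Metric.isOpen_ball (x := (0 : E)) (ε := r)).measurableSet (hf n)
  rw [Real.dist_eq, abs_lt] at hgr
  rw [Real.dist_eq, abs_lt] at h1 ⊢
  constructor <;> linarith [hgr.1, hgr.2, h1.1, h1.2]

/-- Let `q ∈ (2,3)`, `V, K : ℝ³ → ℝ` continuous and positive, `K`
bounded, `K ≤ M·V` pointwise, and assume the uniform vanishing condition on `K`
over sequences of Borel sets of uniformly bounded measure.  Let `(uₙ)`, `u` be
measurable `ℝ³ → ℂ⁴` with `∫ V·|uₙ|² ≤ C'`, `∫ |uₙ|³ ≤ C'`, with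
`∫ K·|u|^q < ∞`, and with `∫_{B_r(0)} K·|uₙ|^q → ∫_{B_r(0)} K·|u|^q` for every
`r > 0`.  Then `∫_{ℝ³} K·|uₙ|^q → ∫_{ℝ³} K·|u|^q`. -/
theorem stmt_13 (q : ℝ) (hq : 2 < q) (hq' : q < 3)
    (V K : EuclideanSpace ℝ (Fin 3) → ℝ)
    (hVc : Continuous V) (hKc : Continuous K)
    (hVpos : ∀ x, 0 < V x) (hKpos : ∀ x, 0 < K x)
    (Kbd : ℝ) (hKbd : ∀ x, K x ≤ Kbd)
    (M : ℝ) (hM : 0 < M) (hKV : ∀ x, K x ≤ M * V x)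
    (hK1 : ∀ R : ℝ, 0 < R → ∀ A : ℕ → Set (EuclideanSpace ℝ (Fin 3)),
      (∀ n, MeasurableSet (A n)) → (∀ n, volume (A n) ≤ ENNReal.ofReal R) →
      ∀ ε : ℝ, 0 < ε → ∃ r₀ : ℝ, ∀ r : ℝ, r₀ ≤ r → ∀ n : ℕ,
        (∫ x in A n ∩ {x | r < ‖x‖}, K x) ≤ ε)
    (u : ℕ → EuclideanSpace ℝ (Fin 3) → EuclideanSpace ℂ (Fin 4))
    (u₀ : EuclideanSpace ℝ (Fin 3) → EuclideanSpace ℂ (Fin 4))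
    (hu : ∀ n, MeasureTheory.StronglyMeasurable (u n))
    (hu₀ : MeasureTheory.StronglyMeasurable u₀)
    (C' : ℝ) (hC' : 0 < C')
    (hbound2 : ∀ n, (∫⁻ x, ENNReal.ofReal (V x * ‖u n x‖ ^ 2)) ≤ ENNReal.ofReal C')
    (hbound3 : ∀ n, (∫⁻ x, ENNReal.ofReal (‖u n x‖ ^ 3)) ≤ ENNReal.ofReal C')
    (hu₀int : Integrable (fun x => K x * ‖u₀ x‖ ^ q))
    (hball : ∀ r : ℝ, 0 < r →
      Filter.Tendsto (fun n => ∫ x in Metric.ball (0 : EuclideanSpace ℝ (Fin 3)) r,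
          K x * ‖u n x‖ ^ q) Filter.atTop
        (nhds (∫ x in Metric.ball (0 : EuclideanSpace ℝ (Fin 3)) r, K x * ‖u₀ x‖ ^ q))) :
    Filter.Tendsto (fun n => ∫ x, K x * ‖u n x‖ ^ q) Filter.atTop
      (nhds (∫ x, K x * ‖u₀ x‖ ^ q)) := by
  have hsm (n : ℕ) : Measurable fun x => ‖u n x‖ := (hu n).norm.measurable
  have h2 (n : ℕ) := integrable_and_integral_le_of_lintegral_ofReal_le (μ := volume)
    (f := fun x => V x * ‖u n x‖ ^ 2)
    (hVc.measurable.mul ((hsm n).pow_const 2)).aestronglyMeasurable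
    (fun x => mul_nonneg (hVpos x).le (by positivity)) hC'.le (hbound2 n)
  have h3 (n : ℕ) := integrable_and_integral_le_of_lintegral_ofReal_le (μ := volume)
    (f := fun x => ‖u n x‖ ^ 3)
    ((hsm n).pow_const 3).aestronglyMeasurable (fun x => by positivity) hC'.le (hbound3 n)
  have hKbd0 : 0 < Kbd := (hKpos 0).trans_le (hKbd 0)
  have hA (a : ℝ) (n : ℕ) : MeasurableSet {x | a ≤ ‖u n x‖} :=
    measurableSet_le measurable_const (hsm n)
  have hvol (a : ℝ) (ha : 0 < a) (n : ℕ) :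
      volume {x | a ≤ ‖u n x‖} ≤ ENNReal.ofReal (C' / a ^ 3) := by
    rw [ENNReal.ofReal_div_of_pos (by positivity)]
    refine le_trans ?_ (ENNReal.div_le_div_right (hbound3 n) _)
    refine le_trans (measure_mono fun x hx => ?_) (meas_ge_le_lintegral_div
      ((hsm n).pow_const 3).ennreal_ofReal.aemeasurable
      (by simpa using pow_pos ha 3) ENNReal.ofReal_ne_top)
    exact ENNReal.ofReal_le_ofReal (pow_le_pow_left₀ ha.le hx 3)
  have hKA (a : ℝ) (ha : 0 < a) (n : ℕ) : IntegrableOn K {x | a ≤ ‖u n x‖} :=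
    Measure.integrableOn_of_bounded ((hvol a ha n).trans_lt ENNReal.ofReal_lt_top).ne
      hKc.aestronglyMeasurable (M := Kbd)
      (.of_forall fun x => by rw [Real.norm_of_nonneg (hKpos x).le]; exact hKbd x)
  have hdom (a b : ℝ) (ha : 0 < a) (hb : 0 < b) (n : ℕ)
      (x : EuclideanSpace ℝ (Fin 3)) : K x * ‖u n x‖ ^ q ≤
      M * a ^ (q - 2) * (V x * ‖u n x‖ ^ 2) + Kbd * b ^ (q - 3) * ‖u n x‖ ^ 3
        + b ^ q * {x | a ≤ ‖u n x‖}.indicator K x := by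
    have hs := rpow_le_sq_add_cube_add_indicator hq.le hq'.le ha hb (norm_nonneg (u n x))
    have e : K x * (Set.Ici a).indicator (fun _ => b ^ q) ‖u n x‖
        = b ^ q * {x | a ≤ ‖u n x‖}.indicator K x := by
      by_cases h : a ≤ ‖u n x‖ <;> simp [Set.indicator, h, mul_comm]
    have k2 := mul_le_mul_of_nonneg_right (hKV x)
      (by positivity : 0 ≤ a ^ (q - 2) * ‖u n x‖ ^ 2)
    have k3 := mul_le_mul_of_nonneg_right (hKbd x)
      (by positivity : 0 ≤ b ^ (q - 3) * ‖u n x‖ ^ 3)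
    have k := mul_le_mul_of_nonneg_left hs (hKpos x).le
    rw [mul_add, mul_add, e] at k
    linarith
  have hdomint (a b : ℝ) (ha : 0 < a) (n : ℕ) : Integrable fun x =>
      M * a ^ (q - 2) * (V x * ‖u n x‖ ^ 2) + Kbd * b ^ (q - 3) * ‖u n x‖ ^ 3
        + b ^ q * {x | a ≤ ‖u n x‖}.indicator K x :=
    (((h2 n).1.const_mul _).add ((h3 n).1.const_mul _)).add
      (((integrable_indicator_iff (hA a n)).mpr (hKA a ha n)).const_mul _)
  have hnn (n : ℕ) (x : EuclideanSpace ℝ (Fin 3)) : 0 ≤ K x * ‖u n x‖ ^ q :=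
    mul_nonneg (hKpos x).le (by positivity)
  have hint (n : ℕ) : Integrable fun x => K x * ‖u n x‖ ^ q :=
    (hdomint 1 1 one_pos n).mono'
      (hKc.measurable.mul ((hsm n).pow_const q)).aestronglyMeasurable
      (.of_forall fun x => by
        rw [Real.norm_of_nonneg (hnn n x)]
        exact hdom 1 1 one_pos one_pos n x)
  refine tendsto_integral_of_tendsto_ball_of_tail hint hnn hu₀int hball fun ε hε => ?_
  obtain ⟨a, ha, haε⟩ : ∃ a : ℝ, 0 < a ∧ M * a ^ (q - 2) * C' < ε / 3 := by
    have h : Filter.Tendsto (fun a : ℝ => M * a ^ (q - 2) * C') (nhdsWithin 0 (Set.Ioi 0))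
        (nhds (M * 0 ^ (q - 2) * C')) :=
      (((Real.continuousAt_rpow_const 0 (q - 2) (Or.inr (by linarith))).tendsto.mono_left
        nhdsWithin_le_nhds).const_mul M).mul_const C'
    rw [Real.zero_rpow (by linarith), mul_zero, zero_mul] at h
    exact ((eventually_mem_nhdsWithin (s := Set.Ioi (0 : ℝ))).and
      (h.eventually (gt_mem_nhds (by positivity : 0 < ε / 3)))).exists
  obtain ⟨b, hb, hbε⟩ : ∃ b : ℝ, 0 < b ∧ Kbd * b ^ (q - 3) * C' < ε / 3 := by
    have h := ((tendsto_rpow_neg_atTop (by linarith : 0 < 3 - q)).const_mul Kbd).mul_const C'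
    rw [mul_zero, zero_mul, neg_sub] at h
    exact ((Filter.eventually_gt_atTop 0).and
      (h.eventually (gt_mem_nhds (by positivity : 0 < ε / 3)))).exists
  have hbq : 0 < b ^ q := by positivity
  obtain ⟨r₀, hr₀⟩ := hK1 (C' / a ^ 3) (by positivity) (fun n => {x | a ≤ ‖u n x‖}) (hA a)
    (hvol a ha) (ε / 3 / b ^ q) (by positivity)
  refine ⟨r₀ + 1, fun r hr n => ?_⟩
  let T := (Metric.ball (0 : EuclideanSpace ℝ (Fin 3)) r)ᶜ
  have htailK : ∫ x in T, {x | a ≤ ‖u n x‖}.indicator K x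
      ≤ ε / 3 / b ^ q := by
    rw [setIntegral_indicator (hA a n), Set.inter_comm]
    refine le_trans (setIntegral_mono_set ((hKA a ha n).mono_set Set.inter_subset_left)
      (.of_forall fun x => (hKpos x).le) (LE.le.eventuallyLE ?_)) (hr₀ r₀ le_rfl n)
    refine Set.inter_subset_inter_right _ fun x hx => ?_
    have : r ≤ ‖x‖ := by simpa [T] using hx
    show r₀ < ‖x‖
    linarith
  have htail2 : ∫ x in T, V x * ‖u n x‖ ^ 2 ≤ C' :=
    (setIntegral_le_integral (h2 n).1 (.of_forall fun x =>
      mul_nonneg (hVpos x).le (by positivity))).trans (h2 n).2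
  have htail3 : ∫ x in T, ‖u n x‖ ^ 3 ≤ C' :=
    (setIntegral_le_integral (h3 n).1 (.of_forall fun x => by positivity)).trans (h3 n).2
  calc ∫ x in T, K x * ‖u n x‖ ^ q
    _ ≤ ∫ x in T, (M * a ^ (q - 2) * (V x * ‖u n x‖ ^ 2)
        + Kbd * b ^ (q - 3) * ‖u n x‖ ^ 3 + b ^ q * {x | a ≤ ‖u n x‖}.indicator K x) :=
      integral_mono (hint n).integrableOn (hdomint a b ha n).integrableOn (hdom a b ha hb n)
    _ = M * a ^ (q - 2) * (∫ x in T, V x * ‖u n x‖ ^ 2)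
        + Kbd * b ^ (q - 3) * (∫ x in T, ‖u n x‖ ^ 3)
        + b ^ q * ∫ x in T, {x | a ≤ ‖u n x‖}.indicator K x := by
      have i2 := ((h2 n).1.const_mul (M * a ^ (q - 2))).integrableOn (s := T)
      have i3 := ((h3 n).1.const_mul (Kbd * b ^ (q - 3))).integrableOn (s := T)
      have iK := (((integrable_indicator_iff (hA a n)).mpr (hKA a ha n)).const_mul
        (b ^ q)).integrableOn (s := T)
      rw [← integral_const_mul, ← integral_const_mul, ← integral_const_mul, ← integral_add i2 i3]
      exact integral_add (i2.add i3) iK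
    _ ≤ M * a ^ (q - 2) * C' + Kbd * b ^ (q - 3) * C' + b ^ q * (ε / 3 / b ^ q) := by
      gcongr
    _ ≤ ε := by
      rw [mul_div_cancel₀ _ hbq.ne']
      linarith
end

section
/- Let q ∈ (2,3). Let V, K : ℝ³ → ℝ be continuous with V(x) > 0 and K(x) > 0 for all x, and suppose K(x)/V(x)^{3−q} → 0 as |x| → +∞. Let (u_n) and u be measurable functions ℝ³ → ℂ⁴ such that ∫_{ℝ³} V·|u_n|² dx ≤ C' and ∫_{ℝ³} |u_n|³ dx ≤ C' for all n, ∫_{ℝ³} K·|u|^q dx < ∞, and for every r > 0 one has ∫_{B_r(0)} K·|u_n|^q dx → ∫_{B_r(0)} K·|u|^q dx as n → ∞. Then ∫_{ℝ³} K·|u_n|^q dx → ∫_{ℝ³} K·|u|^q dx as n → ∞. -/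
open MeasureTheory

/-- Interpolation between the exponents `2` (with weight) and `3`. -/
theorem rpow_mul_rpow_le_weighted_add {q v t : ℝ} (hq : 2 < q) (hq' : q < 3)
    (hv : 0 ≤ v) (ht : 0 ≤ t) :
    v ^ (3 - q) * t ^ q ≤ v * t ^ 2 + t ^ 3 := by
  have h := Real.geom_mean_le_arith_mean2_weighted (w₁ := 3 - q) (w₂ := q - 2)
    (p₁ := v * t ^ 2) (p₂ := t ^ 3) (by linarith) (by linarith) (by positivity)
    (by positivity) (by ring)
  have e : (v * t ^ 2) ^ (3 - q) * (t ^ 3) ^ (q - 2) = v ^ (3 - q) * t ^ q := by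
    rw [Real.mul_rpow hv (by positivity), ← Real.rpow_natCast t 2, ← Real.rpow_natCast t 3,
      ← Real.rpow_mul ht, ← Real.rpow_mul ht, mul_assoc,
      ← Real.rpow_add_of_nonneg ht (by push_cast; linarith) (by push_cast; linarith)]
    congr 2
    push_cast
    ring
  rw [e] at h
  have h1 : 0 ≤ v * t ^ 2 := by positivity
  have h2 : 0 ≤ t ^ 3 := by positivity
  nlinarith

/-- If integrals over balls of every radius converge and the tails are uniformly small, then the
full integrals converge. -/
theorem tendsto_integral_of_tendsto_setIntegral_ball_of_tail {E : Type*}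
    [NormedAddCommGroup E] [MeasurableSpace E] [BorelSpace E] {μ : Measure E}
    {f : ℕ → E → ℝ} {g : E → ℝ} (hf : ∀ n, Integrable (f n) μ) (hg : Integrable g μ)
    (hball : ∀ r : ℝ, 0 < r → Filter.Tendsto (fun n => ∫ x in Metric.ball (0 : E) r, f n x ∂μ)
      Filter.atTop (nhds (∫ x in Metric.ball (0 : E) r, g x ∂μ)))
    (htail : ∀ ε : ℝ, 0 < ε → ∃ R : ℝ, ∀ r, R ≤ r → ∀ n,
      |∫ x in (Metric.ball (0 : E) r)ᶜ, f n x ∂μ| ≤ ε) :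
    Filter.Tendsto (fun n => ∫ x, f n x ∂μ) Filter.atTop (nhds (∫ x, g x ∂μ)) := by
  rw [Metric.tendsto_atTop]
  intro ε hε
  obtain ⟨R, hR⟩ := htail (ε / 4) (by linarith)
  have hlim : Filter.Tendsto (fun m : ℕ => ∫ x in Metric.ball (0 : E) m, g x ∂μ) Filter.atTop
      (nhds (∫ x, g x ∂μ)) := by
    have h := tendsto_setIntegral_of_monotone (μ := μ) (f := g)
      (s := fun m : ℕ => Metric.ball (0 : E) m) (fun m => measurableSet_ball)
      (fun a b hab => Metric.ball_subset_ball (by exact_mod_cast hab)) hg.integrableOn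
    rwa [Metric.iUnion_ball_nat, setIntegral_univ] at h
  obtain ⟨m, hm1, hmR, hm0⟩ := ((Metric.tendsto_nhds.1 hlim (ε / 4) (by linarith)).and
    (((tendsto_natCast_atTop_atTop (R := ℝ)).eventually_ge_atTop R).and
      ((tendsto_natCast_atTop_atTop (R := ℝ)).eventually_gt_atTop 0))).exists
  obtain ⟨N, hN⟩ := Metric.tendsto_atTop.1 (hball m hm0) (ε / 4) (by linarith)
  refine ⟨N, fun n hn => ?_⟩
  have h1 := hN n hn
  have h2 := hR m hmR n
  have h3 := integral_add_compl (measurableSet_ball (x := (0 : E)) (ε := (m : ℝ))) (hf n)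
  rw [Real.dist_eq, abs_lt] at *
  rw [abs_le] at h2
  constructor <;> linarith [h1.1, h1.2, h2.1, h2.2, hm1.1, hm1.2]

/-- Let `q ∈ (2,3)`, `V, K : ℝ³ → ℝ` continuous and positive with
`K(x)/V(x)^(3−q) → 0` as `|x| → ∞`.  Let `(uₙ)`, `u` be measurable `ℝ³ → ℂ⁴`
with `∫ V·|uₙ|² ≤ C'`, `∫ |uₙ|³ ≤ C'`, with `∫ K·|u|^q < ∞`, and with
`∫_{B_r(0)} K·|uₙ|^q → ∫_{B_r(0)} K·|u|^q` for every `r > 0`.  Then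
`∫_{ℝ³} K·|uₙ|^q → ∫_{ℝ³} K·|u|^q`. -/
theorem stmt_14 (q : ℝ) (hq : 2 < q) (hq' : q < 3)
    (V K : EuclideanSpace ℝ (Fin 3) → ℝ)
    (hVc : Continuous V) (hKc : Continuous K)
    (hVpos : ∀ x, 0 < V x) (hKpos : ∀ x, 0 < K x)
    (hVK : Filter.Tendsto (fun x => K x / V x ^ (3 - q))
      (Filter.comap (fun x : EuclideanSpace ℝ (Fin 3) => ‖x‖) Filter.atTop) (nhds 0))
    (u : ℕ → EuclideanSpace ℝ (Fin 3) → EuclideanSpace ℂ (Fin 4))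
    (u₀ : EuclideanSpace ℝ (Fin 3) → EuclideanSpace ℂ (Fin 4))
    (hu : ∀ n, MeasureTheory.StronglyMeasurable (u n))
    (hu₀ : MeasureTheory.StronglyMeasurable u₀)
    (C' : ℝ) (hC' : 0 < C')
    (hbound2 : ∀ n, (∫⁻ x, ENNReal.ofReal (V x * ‖u n x‖ ^ 2)) ≤ ENNReal.ofReal C')
    (hbound3 : ∀ n, (∫⁻ x, ENNReal.ofReal (‖u n x‖ ^ 3)) ≤ ENNReal.ofReal C')
    (hu₀int : Integrable (fun x => K x * ‖u₀ x‖ ^ q))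
    (hball : ∀ r : ℝ, 0 < r →
      Filter.Tendsto (fun n => ∫ x in Metric.ball (0 : EuclideanSpace ℝ (Fin 3)) r,
          K x * ‖u n x‖ ^ q) Filter.atTop
        (nhds (∫ x in Metric.ball (0 : EuclideanSpace ℝ (Fin 3)) r, K x * ‖u₀ x‖ ^ q))) :
    Filter.Tendsto (fun n => ∫ x, K x * ‖u n x‖ ^ q) Filter.atTop
      (nhds (∫ x, K x * ‖u₀ x‖ ^ q)) := by
  have hw : ∀ x, 0 < V x ^ (3 - q) := fun x => Real.rpow_pos_of_pos (hVpos x) _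
  have hcont : Continuous fun x => K x / V x ^ (3 - q) :=
    hKc.div (hVc.rpow_const fun x => Or.inl (hVpos x).ne') fun x => (hw x).ne'
  have hfar : ∀ δ : ℝ, 0 < δ → ∃ R : ℝ, ∀ x, R ≤ ‖x‖ → K x ≤ δ * V x ^ (3 - q) := by
    intro δ hδ
    have h := hVK.eventually_lt_const hδ
    rw [Filter.eventually_comap] at h
    obtain ⟨R, hR⟩ := Filter.eventually_atTop.1 h
    exact ⟨R, fun x hx => ((div_lt_iff₀ (hw x)).1 (hR _ hx x rfl)).le⟩
  obtain ⟨M, hM⟩ : ∃ M : ℝ, ∀ x, K x ≤ M * V x ^ (3 - q) := by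
    obtain ⟨R, hR⟩ := hfar 1 one_pos
    obtain ⟨B, hB⟩ := (isCompact_closedBall (0 : EuclideanSpace ℝ (Fin 3)) R).bddAbove_image
      hcont.continuousOn
    refine ⟨max B 1, fun x => ?_⟩
    rcases le_total R ‖x‖ with h | h
    · exact (hR x h).trans (mul_le_mul_of_nonneg_right (le_max_right _ _) (hw x).le)
    · refine ((div_le_iff₀ (hw x)).1 ?_).trans
        (mul_le_mul_of_nonneg_right (le_max_left _ _) (hw x).le)
      exact hB ⟨x, by simpa using h, rfl⟩
  have hinterp : ∀ (c : ℝ) (n : ℕ) (x), 0 ≤ c → K x ≤ c * V x ^ (3 - q) →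
      K x * ‖u n x‖ ^ q ≤ c * (V x * ‖u n x‖ ^ 2 + ‖u n x‖ ^ 3) := by
    intro c n x hc h
    calc K x * ‖u n x‖ ^ q ≤ c * V x ^ (3 - q) * ‖u n x‖ ^ q := by gcongr
      _ = c * (V x ^ (3 - q) * ‖u n x‖ ^ q) := by ring
      _ ≤ _ := mul_le_mul_of_nonneg_left
        (rpow_mul_rpow_le_weighted_add hq hq' (hVpos x).le (norm_nonneg _)) hc
  have hnonneg : ∀ n x, 0 ≤ K x * ‖u n x‖ ^ q := fun n x =>
    mul_nonneg (hKpos x).le (Real.rpow_nonneg (norm_nonneg _) _)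
  have hbnonneg : ∀ n x, 0 ≤ V x * ‖u n x‖ ^ 2 + ‖u n x‖ ^ 3 := fun n x =>
    add_nonneg (mul_nonneg (hVpos x).le (by positivity)) (by positivity)
  have h2 := fun n => integrable_and_integral_le_of_lintegral_ofReal_le
    (hVc.aestronglyMeasurable.mul ((hu n).norm.pow 2).aestronglyMeasurable)
    (fun x => mul_nonneg (hVpos x).le (sq_nonneg ‖u n x‖)) hC'.le (hbound2 n)
  have h3 := fun n => integrable_and_integral_le_of_lintegral_ofReal_le
    ((hu n).norm.pow 3).aestronglyMeasurable
    (fun x => pow_nonneg (norm_nonneg (u n x)) 3) hC'.le (hbound3 n)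
  have hbint : ∀ n, Integrable fun x => V x * ‖u n x‖ ^ 2 + ‖u n x‖ ^ 3 := fun n =>
    (h2 n).1.add (h3 n).1
  have hble : ∀ n, ∫ x, (V x * ‖u n x‖ ^ 2 + ‖u n x‖ ^ 3) ≤ 2 * C' := fun n => by
    have h := integral_add (h2 n).1 (h3 n).1
    have h2' := (h2 n).2
    have h3' := (h3 n).2
    simp only [Pi.mul_apply, Pi.pow_apply] at h h2' h3'
    linarith
  have hM0 : 0 ≤ M := (pos_of_mul_pos_left ((hKpos 0).trans_le (hM 0)) (hw 0).le).le
  have hint : ∀ n, Integrable fun x => K x * ‖u n x‖ ^ q := fun n => by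
    refine ((hbint n).const_mul M).mono'
      (hKc.aestronglyMeasurable.mul
        ((hu n).norm.measurable.pow_const q).aestronglyMeasurable)
      (Filter.Eventually.of_forall fun x => ?_)
    rw [Real.norm_of_nonneg (hnonneg n x)]
    exact hinterp M n x hM0 (hM x)
  refine tendsto_integral_of_tendsto_setIntegral_ball_of_tail hint hu₀int hball fun ε hε => ?_
  have hδ : 0 < ε / (2 * C') := by positivity
  obtain ⟨R, hR⟩ := hfar _ hδ
  refine ⟨R, fun r hr n => ?_⟩
  rw [abs_of_nonneg (integral_nonneg (hnonneg n))]
  have hbc := (hbint n).const_mul (ε / (2 * C'))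
  calc ∫ x in (Metric.ball 0 r)ᶜ, K x * ‖u n x‖ ^ q
      ≤ ∫ x in (Metric.ball 0 r)ᶜ, ε / (2 * C') * (V x * ‖u n x‖ ^ 2 + ‖u n x‖ ^ 3) := by
        refine setIntegral_mono_on (hint n).integrableOn hbc.integrableOn
          measurableSet_ball.compl fun x hx => hinterp _ n x hδ.le (hR x ?_)
        exact hr.trans (by simpa using hx)
    _ ≤ ∫ x, ε / (2 * C') * (V x * ‖u n x‖ ^ 2 + ‖u n x‖ ^ 3) :=
        setIntegral_le_integral hbc
          (Filter.Eventually.of_forall fun x => mul_nonneg hδ.le (hbnonneg n x))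
    _ = ε / (2 * C') * ∫ x, (V x * ‖u n x‖ ^ 2 + ‖u n x‖ ^ 3) := integral_const_mul _ _
    _ ≤ ε / (2 * C') * (2 * C') := mul_le_mul_of_nonneg_left (hble n) hδ.le
    _ = ε := by field_simp
end

section
/- Let p ∈ (2,3), c₁, c₂ > 0, and let F : [0,∞) → ℝ be continuous with 0 ≤ F(s) ≤ (c₁/2)·s² + (c₂/p)·s^p for all s ≥ 0. Let K : ℝ³ → [0,∞) be measurable, and let (u_n) and u be measurable functions ℝ³ → ℂ⁴ such that u_n → u almost everywhere, ∫_{ℝ³} K·|u_n|² dx → ∫_{ℝ³} K·|u|² dx < ∞, and ∫_{ℝ³} K·|u_n|^p dx → ∫_{ℝ³} K·|u|^p dx < ∞. Then ∫_{ℝ³} K·F(|u_n|) dx → ∫_{ℝ³} K·F(|u|) dx as n → ∞. -/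
open MeasureTheory

open Filter Topology in
/-- Generalized dominated convergence for nonnegative functions: the dominating functions may vary,
as long as they converge almost everywhere and their integrals converge to the integral of the
limit. -/
theorem tendsto_integral_of_nonneg_of_le_of_tendsto_integral {α : Type*} [MeasurableSpace α]
    {μ : Measure α} {f g : ℕ → α → ℝ} {f₀ g₀ : α → ℝ}
    (hf_meas : ∀ n, AEStronglyMeasurable (f n) μ)
    (hg_int : ∀ n, Integrable (g n) μ) (hg₀_int : Integrable g₀ μ)
    (hf_nonneg : ∀ n, ∀ᵐ x ∂μ, 0 ≤ f n x) (hfg : ∀ n, ∀ᵐ x ∂μ, f n x ≤ g n x)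
    (hf_lim : ∀ᵐ x ∂μ, Tendsto (fun n => f n x) atTop (𝓝 (f₀ x)))
    (hg_lim : ∀ᵐ x ∂μ, Tendsto (fun n => g n x) atTop (𝓝 (g₀ x)))
    (h_int : Tendsto (fun n => ∫ x, g n x ∂μ) atTop (𝓝 (∫ x, g₀ x ∂μ))) :
    Tendsto (fun n => ∫ x, f n x ∂μ) atTop (𝓝 (∫ x, f₀ x ∂μ)) := by
  have h_nonneg : ∀ᵐ x ∂μ, ∀ n, 0 ≤ f n x := ae_all_iff.2 hf_nonneg
  have h_le : ∀ᵐ x ∂μ, ∀ n, f n x ≤ g n x := ae_all_iff.2 hfg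
  have hg₀_nonneg : ∀ᵐ x ∂μ, 0 ≤ g₀ x := by
    filter_upwards [h_nonneg, h_le, hg_lim] with x h0 h1 hg
    exact ge_of_tendsto' hg fun n => (h0 n).trans (h1 n)
  have hf_int : ∀ n, Integrable (f n) μ := fun n =>
    (hg_int n).mono' (hf_meas n) <| by
      filter_upwards [hf_nonneg n, hfg n] with x h0 h1
      rwa [Real.norm_of_nonneg h0]
  have hmin_f : Tendsto (fun n => ∫ x, min (f n x) (g₀ x) ∂μ) atTop (𝓝 (∫ x, f₀ x ∂μ)) := by
    refine tendsto_integral_of_dominated_convergence g₀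
      (fun n => ((hf_int n).inf hg₀_int).aestronglyMeasurable) hg₀_int (fun n => ?_) ?_
    · filter_upwards [hf_nonneg n, hg₀_nonneg] with x h0 h1
      rw [Real.norm_of_nonneg (le_min h0 h1)]
      exact min_le_right _ _
    · filter_upwards [hf_lim, hg_lim, h_le] with x hf hg h1
      have := hf.min (tendsto_const_nhds (x := g₀ x))
      rwa [min_eq_left (le_of_tendsto_of_tendsto' hf hg h1)] at this
  have hmin_g : Tendsto (fun n => ∫ x, min (g n x) (g₀ x) ∂μ) atTop (𝓝 (∫ x, g₀ x ∂μ)) := by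
    refine tendsto_integral_of_dominated_convergence g₀
      (fun n => ((hg_int n).inf hg₀_int).aestronglyMeasurable) hg₀_int (fun n => ?_) ?_
    · filter_upwards [hf_nonneg n, hfg n, hg₀_nonneg] with x h0 h1 h2
      rw [Real.norm_of_nonneg (le_min (h0.trans h1) h2)]
      exact min_le_right _ _
    · filter_upwards [hg_lim] with x hg
      simpa using hg.min (tendsto_const_nhds (x := g₀ x))
  have hupper := hmin_f.add (h_int.sub hmin_g)
  rw [sub_self, add_zero] at hupper
  refine tendsto_of_tendsto_of_tendsto_of_le_of_le hmin_f hupper (fun n => ?_) (fun n => ?_)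
  · exact integral_mono ((hf_int n).inf hg₀_int) (hf_int n) fun x => min_le_left _ _
  · have hmf : Integrable (fun x => min (f n x) (g₀ x)) μ := (hf_int n).inf hg₀_int
    have hmg : Integrable (fun x => min (g n x) (g₀ x)) μ := (hg_int n).inf hg₀_int
    have hgap : Integrable (fun x => g n x - min (g n x) (g₀ x)) μ := (hg_int n).sub hmg
    dsimp only
    rw [← integral_sub (hg_int n) hmg, ← integral_add hmf hgap]
    refine integral_mono_ae (hf_int n) (hmf.add hgap) ?_
    filter_upwards [hfg n] with x h1
    rcases le_total (f n x) (g₀ x) with h | h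
    · simp [min_eq_left h]
    · simpa [min_eq_right h, min_eq_right (h.trans h1)] using h1

/-- Let `p ∈ (2,3)`, `c₁, c₂ > 0`, and `F : [0,∞) → ℝ` continuous
with `0 ≤ F(s) ≤ (c₁/2)·s² + (c₂/p)·s^p` for all `s ≥ 0`.  Let `K : ℝ³ → [0,∞)`
be measurable, and `(uₙ)`, `u` measurable `ℝ³ → ℂ⁴` with `uₙ → u` a.e.,
`∫ K·|uₙ|² → ∫ K·|u|² < ∞` and `∫ K·|uₙ|^p → ∫ K·|u|^p < ∞`.  Then
`∫ K·F(|uₙ|) → ∫ K·F(|u|)`. -/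
theorem stmt_17 (p : ℝ) (hp : 2 < p) (hp' : p < 3)
    (c₁ c₂ : ℝ) (hc₁ : 0 < c₁) (hc₂ : 0 < c₂)
    (F : ℝ → ℝ) (hFc : ContinuousOn F (Set.Ici 0))
    (hF : ∀ s : ℝ, 0 ≤ s → 0 ≤ F s ∧ F s ≤ c₁ / 2 * s ^ 2 + c₂ / p * s ^ p)
    (K : EuclideanSpace ℝ (Fin 3) → ℝ) (hKm : Measurable K) (hK0 : ∀ x, 0 ≤ K x)
    (u : ℕ → EuclideanSpace ℝ (Fin 3) → EuclideanSpace ℂ (Fin 4))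
    (u₀ : EuclideanSpace ℝ (Fin 3) → EuclideanSpace ℂ (Fin 4))
    (hu : ∀ n, MeasureTheory.StronglyMeasurable (u n))
    (hu₀ : MeasureTheory.StronglyMeasurable u₀)
    (hae : ∀ᵐ x ∂volume, Filter.Tendsto (fun n => u n x) Filter.atTop (nhds (u₀ x)))
    (hint2 : ∀ n, Integrable (fun x => K x * ‖u n x‖ ^ 2))
    (hint2' : Integrable (fun x => K x * ‖u₀ x‖ ^ 2))
    (hconv2 : Filter.Tendsto (fun n => ∫ x, K x * ‖u n x‖ ^ 2) Filter.atTop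
      (nhds (∫ x, K x * ‖u₀ x‖ ^ 2)))
    (hintp : ∀ n, Integrable (fun x => K x * ‖u n x‖ ^ p))
    (hintp' : Integrable (fun x => K x * ‖u₀ x‖ ^ p))
    (hconvp : Filter.Tendsto (fun n => ∫ x, K x * ‖u n x‖ ^ p) Filter.atTop
      (nhds (∫ x, K x * ‖u₀ x‖ ^ p))) :
    Filter.Tendsto (fun n => ∫ x, K x * F ‖u n x‖) Filter.atTop
      (nhds (∫ x, K x * F ‖u₀ x‖)) := by
  have hF_comp : Continuous fun v : EuclideanSpace ℂ (Fin 4) => F ‖v‖ :=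
    hFc.comp_continuous continuous_norm fun v => norm_nonneg v
  have hbound_cont : Continuous fun v : EuclideanSpace ℂ (Fin 4) => ‖v‖ ^ p :=
    continuous_norm.rpow_const fun _ => Or.inr (by linarith)
  have hg_int : ∀ v : EuclideanSpace ℝ (Fin 3) → EuclideanSpace ℂ (Fin 4),
      Integrable (fun x => K x * ‖v x‖ ^ 2) → Integrable (fun x => K x * ‖v x‖ ^ p) →
      Integrable (fun x => c₁ / 2 * (K x * ‖v x‖ ^ 2) + c₂ / p * (K x * ‖v x‖ ^ p)) :=
    fun v h2 hp => (h2.const_mul _).add (hp.const_mul _)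
  have hg_integral : ∀ v : EuclideanSpace ℝ (Fin 3) → EuclideanSpace ℂ (Fin 4),
      Integrable (fun x => K x * ‖v x‖ ^ 2) → Integrable (fun x => K x * ‖v x‖ ^ p) →
      ∫ x, (c₁ / 2 * (K x * ‖v x‖ ^ 2) + c₂ / p * (K x * ‖v x‖ ^ p)) =
        c₁ / 2 * (∫ x, K x * ‖v x‖ ^ 2) + c₂ / p * ∫ x, K x * ‖v x‖ ^ p :=
    fun v h2 hp => by
      rw [integral_add (h2.const_mul _) (hp.const_mul _), integral_const_mul, integral_const_mul]
  refine tendsto_integral_of_nonneg_of_le_of_tendsto_integral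
    (g := fun n x => c₁ / 2 * (K x * ‖u n x‖ ^ 2) + c₂ / p * (K x * ‖u n x‖ ^ p))
    (g₀ := fun x => c₁ / 2 * (K x * ‖u₀ x‖ ^ 2) + c₂ / p * (K x * ‖u₀ x‖ ^ p))
    (fun n => ?_) (fun n => hg_int _ (hint2 n) (hintp n)) (hg_int _ hint2' hintp')
    (fun n => ?_) (fun n => ?_) ?_ ?_ ?_
  · exact hKm.aestronglyMeasurable.mul (hF_comp.comp_stronglyMeasurable (hu n)).aestronglyMeasurable
  · exact .of_forall fun x => mul_nonneg (hK0 x) (hF _ (norm_nonneg _)).1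
  · refine .of_forall fun x => ?_
    calc K x * F ‖u n x‖ ≤ K x * (c₁ / 2 * ‖u n x‖ ^ 2 + c₂ / p * ‖u n x‖ ^ p) :=
          mul_le_mul_of_nonneg_left (hF _ (norm_nonneg _)).2 (hK0 x)
      _ = _ := by ring
  · filter_upwards [hae] with x hx
    exact ((hF_comp.tendsto _).comp hx).const_mul _
  · filter_upwards [hae] with x hx
    exact (((hx.norm.pow 2).const_mul _).const_mul _).add
      ((((hbound_cont.tendsto _).comp hx).const_mul _).const_mul _)
  · rw [hg_integral _ hint2' hintp']
    simp_rw [fun n => hg_integral _ (hint2 n) (hintp n)]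
    exact (hconv2.const_mul _).add (hconvp.const_mul _)
end
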